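/- arXiv:math/0312368 — 2 statements merged into one kernel-verified Lean document; each statement's English description precedes it below -/
import Mathlib

section
/- The field K = k(q_r : r = 1, 2, …) generated by all the observables q_r satisfies K = k(c_1, …, c_{N/2}) = k(q_1, …, q_{N/2}), where N = n(n-1). -/
noncomputable section

open scoped Classical

abbrev RF (k : Type) [Field k] (n : ℕ) := FractionRing (MvPolynomial (Fin n) k)

def xv (k : Type) [Field k] (n : ℕ) (i : Fin n) : RF k n :=
  algebraMap (MvPolynomial (Fin n) k) (RF k n) (MvPolynomial.X i)

/-- The multiset of the `N = n(n-1)` ratios `x_i / x_j`, `i ≠ j`. -/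
def ratioMultiset (k : Type) [Field k] (n : ℕ) : Multiset (RF k n) :=
  ((Finset.univ.filter fun p : Fin n × Fin n => p.1 ≠ p.2).val).map
    fun p => xv k n p.1 / xv k n p.2

/-- `c_i`, the `i`-th elementary symmetric function of the ratios `x_i/x_j`. -/
def cCoef (k : Type) [Field k] (n : ℕ) (i : ℕ) : RF k n :=
  (ratioMultiset k n).esymm i

/-- The observable `q_r = tr(X^r) · tr(X^{-r})`. -/
def qObs (k : Type) [Field k] (n : ℕ) (r : ℤ) : RF k n :=
  (∑ i, xv k n i ^ r) * (∑ i, xv k n i ^ (-r))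

/-- The field `K = k(q_r : r = 1, 2, …)` generated by all the observables. -/
def KObs (k : Type) [Field k] (n : ℕ) : IntermediateField k (RF k n) :=
  IntermediateField.adjoin k {a | ∃ r : ℕ, 1 ≤ r ∧ a = qObs k n (r : ℤ)}

section NewtonIdentities

open MvPolynomial

variable {k L σ : Type*} [Field k] [Field L] [Algebra k L] [Fintype σ]
  (F : IntermediateField k L) (f : σ → L)

theorem aeval_esymm_mem_of_psum_mem [CharZero L] {m : ℕ}
    (h : ∀ r, 1 ≤ r → r ≤ m → aeval f (psum σ k r) ∈ F) (i : ℕ) (hi : i ≤ m) :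
    aeval f (esymm σ k i) ∈ F := by
  induction i using Nat.strong_induction_on with
  | _ i ih =>
    rcases Nat.eq_zero_or_pos i with rfl | hpos
    · simp [F.one_mem]
    · have newton := congrArg (aeval f) (mul_esymm_eq_sum σ k i)
      simp only [map_mul, map_natCast, map_sum, map_pow, map_neg, map_one] at newton
      have hne : (i : L) ≠ 0 := Nat.cast_ne_zero.2 hpos.ne'
      rw [← mul_div_cancel_left₀ (aeval f (esymm σ k i)) hne, newton]
      refine F.div_mem (F.mul_mem (pow_mem (F.neg_mem F.one_mem) _) (F.sum_mem ?_))
        (natCast_mem F i)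
      rintro ⟨a, b⟩ hab
      simp only [Finset.mem_filter, Finset.HasAntidiagonal.mem_antidiagonal] at hab
      exact F.mul_mem (F.mul_mem (pow_mem (F.neg_mem F.one_mem) _)
        (ih a hab.2 (by omega))) (h b (by omega) (by omega))

theorem aeval_psum_mem_of_esymm_mem (h : ∀ i, aeval f (esymm σ k i) ∈ F) (r : ℕ) (hr : 1 ≤ r) :
    aeval f (psum σ k r) ∈ F := by
  induction r using Nat.strong_induction_on with
  | _ r ih =>
    have newton := congrArg (aeval f) (psum_eq_mul_esymm_sub_sum σ k r hr)
    simp only [map_sub, map_mul, map_natCast, map_sum, map_pow, map_neg, map_one] at newton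
    rw [newton]
    refine F.sub_mem (F.mul_mem (F.mul_mem (pow_mem (F.neg_mem F.one_mem) _)
      (natCast_mem F r)) (h r)) (F.sum_mem ?_)
    rintro ⟨a, b⟩ hab
    simp only [Finset.mem_filter, Finset.HasAntidiagonal.mem_antidiagonal, Set.mem_Ioo] at hab
    exact F.mul_mem (F.mul_mem (pow_mem (F.neg_mem F.one_mem) _) (h a))
      (ih b (by omega) (by omega))

/-- If the values `f a` are permuted by inversion and have product `1`, their elementary
symmetric functions are palindromic. -/
theorem aeval_esymm_card_sub (e : Equiv.Perm σ) (he : ∀ a, f (e a) = (f a)⁻¹)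
    (hprod : ∏ a, f a = 1) {i : ℕ} (hi : i ≤ Fintype.card σ) :
    aeval f (esymm σ k (Fintype.card σ - i)) = aeval f (esymm σ k i) := by
  simp only [esymm, map_sum, map_prod, aeval_X]
  refine Finset.sum_bij' (fun t _ => tᶜ.map e.toEmbedding)
    (fun t _ => (t.map e.symm.toEmbedding)ᶜ) ?_ ?_ ?_ ?_ ?_
  · intro t ht
    simp only [Finset.mem_powersetCard_univ, Finset.card_map, Finset.card_compl] at ht ⊢
    omega
  · intro t ht
    simp only [Finset.mem_powersetCard_univ, Finset.card_map, Finset.card_compl] at ht ⊢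
    omega
  · intro t _
    ext a
    simp
  · intro t _
    ext a
    simp
  · intro t _
    rw [Finset.prod_map]
    simp only [Equiv.coe_toEmbedding, he, Finset.prod_inv_distrib]
    exact eq_inv_of_mul_eq_one_left (by rw [Finset.prod_mul_prod_compl, hprod])

end NewtonIdentities

section Ratios

open MvPolynomial

variable (k : Type) [Field k] (n : ℕ)

/-- Ordered pairs of distinct indices. -/
abbrev DistinctPair (n : ℕ) := {p : Fin n × Fin n // p.1 ≠ p.2}

theorem card_distinctPair : Fintype.card (DistinctPair n) = n * (n - 1) := by
  rw [Fintype.card_subtype]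
  have := Finset.offDiag_card (Finset.univ : Finset (Fin n))
  rw [Finset.card_univ, Fintype.card_fin] at this
  rw [Nat.mul_sub_one, ← this]
  congr 1
  ext p
  simp

/-- The ratio `x_i / x_j` attached to a pair of distinct indices. -/
def ratio (p : DistinctPair n) : RF k n := xv k n p.1.1 / xv k n p.1.2

theorem xv_ne_zero (i : Fin n) : xv k n i ≠ 0 := by
  simp [xv]

theorem cCoef_eq_aeval_esymm (i : ℕ) :
    cCoef k n i = aeval (ratio k n) (esymm (DistinctPair n) k i) := by
  rw [aeval_esymm_eq_multiset_esymm, cCoef, ratioMultiset,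
    ← Finset.subtype_map, Finset.map_val, Multiset.map_map]
  simp only [Finset.subtype_univ]
  rfl

theorem qObs_eq_aeval_psum_add (r : ℕ) :
    qObs k n r = aeval (ratio k n) (psum (DistinctPair n) k r) + n := by
  have hdiag : ∑ p : Fin n × Fin n with ¬ p.1 ≠ p.2, (xv k n p.1 / xv k n p.2) ^ r = n := by
    have hset : (Finset.univ.filter fun p : Fin n × Fin n => ¬ p.1 ≠ p.2) =
        (Finset.univ : Finset (Fin n)).diag := by
      ext p
      simp
    rw [hset, Finset.sum_diag]
    simp [xv_ne_zero]
  have hoff : ∑ p : Fin n × Fin n with p.1 ≠ p.2, (xv k n p.1 / xv k n p.2) ^ r =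
      aeval (ratio k n) (psum (DistinctPair n) k r) := by
    simp only [psum, map_sum, map_pow, aeval_X, ratio]
    exact Finset.sum_subtype _ (by simp) _
  rw [← hoff, ← hdiag, Finset.sum_filter_add_sum_filter_not, qObs, Finset.sum_mul_sum,
    Fintype.sum_prod_type]
  simp [div_eq_mul_inv, mul_pow]

/-- Exchanging the two indices of a pair. -/
def DistinctPair.swap : Equiv.Perm (DistinctPair n) :=
  (Equiv.prodComm (Fin n) (Fin n)).subtypeEquiv fun _ => ne_comm

theorem ratio_swap (p : DistinctPair n) :
    ratio k n (DistinctPair.swap n p) = (ratio k n p)⁻¹ :=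
  (inv_div _ _).symm

theorem prod_ratio : ∏ p, ratio k n p = 1 := by
  simp only [ratio, Finset.prod_div_distrib]
  rw [div_eq_one_iff_eq (Finset.prod_ne_zero_iff.2 fun p _ => xv_ne_zero k n _)]
  exact Equiv.prod_comp (DistinctPair.swap n) fun p => xv k n p.1.2

theorem cCoef_mem_of_le_half (F : IntermediateField k (RF k n))
    (h : ∀ i, 1 ≤ i → i ≤ n * (n - 1) / 2 → cCoef k n i ∈ F) (i : ℕ) : cCoef k n i ∈ F := by
  have small : ∀ i, i ≤ n * (n - 1) / 2 → cCoef k n i ∈ F := by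
    intro i hi
    rcases Nat.eq_zero_or_pos i with rfl | hpos
    · simp [cCoef_eq_aeval_esymm, F.one_mem]
    · exact h i hpos hi
  have hcard := card_distinctPair n
  rcases le_or_gt i (n * (n - 1)) with hi | hi
  · rcases le_or_gt i (n * (n - 1) / 2) with hi' | hi'
    · exact small i hi'
    · rw [cCoef_eq_aeval_esymm, ← aeval_esymm_card_sub (ratio k n) (DistinctPair.swap n)
        (ratio_swap k n) (prod_ratio k n) (hcard ▸ hi), ← cCoef_eq_aeval_esymm, hcard]
      exact small _ (by omega)
  · rw [cCoef_eq_aeval_esymm, esymm, Finset.powersetCard_eq_empty.2 (by simpa [hcard] using hi)]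
    simp [F.zero_mem]

theorem qObs_mem_iff (F : IntermediateField k (RF k n)) (r : ℕ) :
    qObs k n r ∈ F ↔ aeval (ratio k n) (psum (DistinctPair n) k r) ∈ F := by
  rw [qObs_eq_aeval_psum_add]
  exact add_mem_cancel_right (natCast_mem F n)

theorem qObs_mem_of_cCoef_mem (F : IntermediateField k (RF k n))
    (h : ∀ i, 1 ≤ i → i ≤ n * (n - 1) / 2 → cCoef k n i ∈ F) (r : ℕ) (hr : 1 ≤ r) :
    qObs k n r ∈ F :=
  (qObs_mem_iff k n F r).2 <| aeval_psum_mem_of_esymm_mem F _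
    (fun i => cCoef_eq_aeval_esymm k n i ▸ cCoef_mem_of_le_half k n F h i) r hr

theorem cCoef_mem_of_qObs_mem [CharZero k] (F : IntermediateField k (RF k n)) {m : ℕ}
    (h : ∀ r : ℕ, 1 ≤ r → r ≤ m → qObs k n r ∈ F) (i : ℕ) (hi : i ≤ m) : cCoef k n i ∈ F := by
  have : CharZero (RF k n) := algebraRat.charZero _
  rw [cCoef_eq_aeval_esymm]
  exact aeval_esymm_mem_of_psum_mem F _
    (fun r hr hrm => (qObs_mem_iff k n F r).1 (h r hr hrm)) i hi

end Ratios

theorem stmt3 (k : Type) [Field k] [CharZero k] (n : ℕ) :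
    KObs k n =
        IntermediateField.adjoin k
          {a | ∃ i : ℕ, 1 ≤ i ∧ i ≤ n * (n - 1) / 2 ∧ a = cCoef k n i} ∧
      KObs k n =
        IntermediateField.adjoin k
          {a | ∃ i : ℕ, 1 ≤ i ∧ i ≤ n * (n - 1) / 2 ∧ a = qObs k n (i : ℤ)} := by
  refine ⟨le_antisymm ?_ ?_, le_antisymm ?_ ?_⟩ <;> refine IntermediateField.adjoin_le_iff.2 ?_
  · rintro _ ⟨r, hr, rfl⟩
    refine qObs_mem_of_cCoef_mem k n _ (fun i hi hi' => ?_) r hr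
    exact IntermediateField.subset_adjoin k _ ⟨i, hi, hi', rfl⟩
  · rintro _ ⟨i, -, -, rfl⟩
    refine cCoef_mem_of_qObs_mem k n _ (fun r hr _ => ?_) i le_rfl
    exact IntermediateField.subset_adjoin k _ ⟨r, hr, rfl⟩
  · rintro _ ⟨r, hr, rfl⟩
    refine qObs_mem_of_cCoef_mem k n _ (fun i _ hi => cCoef_mem_of_qObs_mem k n _ ?_ i hi) r hr
    exact fun r hr hr' => IntermediateField.subset_adjoin k _ ⟨r, hr, hr', rfl⟩
  · rintro _ ⟨r, hr, -, rfl⟩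
    exact IntermediateField.subset_adjoin k _ ⟨r, hr, rfl⟩
end
end

section
/- For every n ≥ 2 and m ≥ 1, the invariant field k(X_1, …, X_m)_0^G is generated over k by the elements q_r = tr(X_1^r)·tr(X_1^{-r}) for r = 1, …, n(n-1)/2, together with the elements q_s^{(h)} = tr(X_1^s X_h)·tr(X_1^{-s} X_h^{-1}) for h = 2, …, m and s = 0, 1, …, n(n-1) − 1. -/
noncomputable section

open scoped Classical

/-- The rational function field `k(x_{11}, …, x_{mn})` in `m` arrays of `n`
variables each. -/
abbrev RFM (k : Type) [Field k] (m n : ℕ) :=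
  FractionRing (MvPolynomial (Fin m × Fin n) k)

/-- The variable `x_{hj}` (the `j`-th entry of the array `X_h`). -/
def xm (k : Type) [Field k] (m n : ℕ) (h : Fin m) (j : Fin n) : RFM k m n :=
  algebraMap (MvPolynomial (Fin m × Fin n) k) (RFM k m n) (MvPolynomial.X (h, j))

/-- The set of ratios `x_{hi}/x_{hj}`, `i ≠ j`, generating `k(X_1, …, X_m)₀`. -/
def ratioSetM (k : Type) [Field k] (m n : ℕ) : Set (RFM k m n) :=
  {r | ∃ h : Fin m, ∃ i j : Fin n, i ≠ j ∧ r = xm k m n h i / xm k m n h j}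

/-- The subgroup of automorphisms generated by the image of `G = S_n × T`, where
`σ ∈ S_n` simultaneously permutes the entries of every array and `τ` inverts all
the variables. -/
def GsubM (k : Type) [Field k] (m n : ℕ) : Subgroup (RFM k m n ≃ₐ[k] RFM k m n) :=
  Subgroup.closure {φ | ∃ σ : Equiv.Perm (Fin n),
    (∀ h j, φ (xm k m n h j) = xm k m n h (σ j)) ∨
      (∀ h j, φ (xm k m n h j) = (xm k m n h (σ j))⁻¹)}

/-- The invariant field `k(X_1, …, X_m)₀^G`. -/
def InvFM (k : Type) [Field k] (m n : ℕ) : IntermediateField k (RFM k m n) :=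
  IntermediateField.adjoin k (ratioSetM k m n) ⊓
    IntermediateField.fixedField (GsubM k m n)

/-- The observable `q_{1,…,1} = tr(X_1⋯X_m) · tr((X_1⋯X_m)⁻¹)`. -/
def q11 (k : Type) [Field k] (m n : ℕ) : RFM k m n :=
  (∑ j, ∏ h, xm k m n h j) * (∑ j, ∏ h, (xm k m n h j)⁻¹)

/-- The observable `tr(X_h^r) · tr(X_h^{-r})`. -/
def qSingle (k : Type) [Field k] (m n : ℕ) (h : Fin m) (r : ℤ) : RFM k m n :=
  (∑ j, xm k m n h j ^ r) * (∑ j, xm k m n h j ^ (-r))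

/-- The mixed observable `q_s^{(h)} = tr(X_1^s X_h) · tr(X_1^{-s} X_h^{-1})`
(with `X_1` given by the index `h₁`). -/
def qMix (k : Type) [Field k] (m n : ℕ) (h₁ h : Fin m) (s : ℤ) : RFM k m n :=
  (∑ j, xm k m n h₁ j ^ s * xm k m n h j) *
    (∑ j, xm k m n h₁ j ^ (-s) * (xm k m n h j)⁻¹)

/-- Over a field of characteristic zero, Newton's identities express a product of `N` elements
through their first `N` power sums. -/
theorem prod_mem_of_sum_pow_mem {k R ι : Type*} [Field k] [CharZero k] [CommRing R] [Algebra k R]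
    [Fintype ι] (S : Subalgebra k R) (u : ι → R)
    (h : ∀ r, 1 ≤ r → r ≤ Fintype.card ι → ∑ i, u i ^ r ∈ S) : ∏ i, u i ∈ S := by
  have key : ∀ r ≤ Fintype.card ι, MvPolynomial.aeval u (MvPolynomial.esymm ι k r) ∈ S := by
    intro r
    induction r using Nat.strong_induction_on with
    | _ r ih =>
      intro hr
      rcases Nat.eq_zero_or_pos r with rfl | hpos
      · simp [MvPolynomial.esymm_zero, one_mem]
      have newton := congrArg (MvPolynomial.aeval u) (MvPolynomial.mul_esymm_eq_sum ι k r)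
      have hmem : (r : R) * MvPolynomial.aeval u (MvPolynomial.esymm ι k r) ∈ S := by
        rw [map_mul, map_natCast] at newton
        rw [newton]
        simp only [map_mul, map_pow, map_neg, map_one, map_sum]
        have hneg : (-1 : R) ∈ S := neg_mem (one_mem S)
        refine mul_mem (pow_mem hneg _) (sum_mem fun a ha => ?_)
        rw [Finset.mem_filter, Finset.HasAntidiagonal.mem_antidiagonal] at ha
        refine mul_mem (mul_mem (pow_mem hneg _) (ih _ ha.2 (by omega))) ?_
        simpa [MvPolynomial.psum] using h a.2 (by omega) (by omega)
      have hr0 : (r : k) ≠ 0 := by exact_mod_cast hpos.ne'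
      have : MvPolynomial.aeval u (MvPolynomial.esymm ι k r) =
          (r : k)⁻¹ • ((r : R) * MvPolynomial.aeval u (MvPolynomial.esymm ι k r)) := by
        rw [← nsmul_eq_mul, ← Nat.cast_smul_eq_nsmul k, smul_smul, inv_mul_cancel₀ hr0, one_smul]
      rw [this]
      exact S.smul_mem hmem _
  have := key _ le_rfl
  rwa [MvPolynomial.esymm, ← Finset.card_univ, Finset.powersetCard_self, Finset.sum_singleton,
    map_prod, Finset.prod_congr rfl fun i _ => MvPolynomial.aeval_X u i] at this

/-- A Vandermonde system with distinct nodes in a subfield and right-hand side in that subfield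
has its solution in the subfield. -/
theorem mem_of_sum_pow_mul_mem {E F ι : Type*} [Field E] [Field F] [Algebra E F] [Fintype ι]
    (L : IntermediateField E F) (y : ι → L) (hy : Function.Injective y) (w : ι → F)
    (h : ∀ s < Fintype.card ι, ∑ i, (y i : F) ^ s * w i ∈ L) (i : ι) : w i ∈ L := by
  have hinj : Set.InjOn y (Finset.univ : Finset ι) := hy.injOn
  set p := Lagrange.basis Finset.univ y i
  have hdeg : p.natDegree + 1 = Fintype.card ι := by
    have : 0 < Fintype.card ι := Fintype.card_pos_iff.mpr ⟨i⟩
    rw [Lagrange.natDegree_basis hinj (Finset.mem_univ i), Finset.card_univ]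
    omega
  have hw : w i = ∑ s ∈ Finset.range (p.natDegree + 1),
      (p.coeff s : F) * ∑ j, (y j : F) ^ s * w j := by
    have heval : ∀ j, ((p.eval (y j) : L) : F) =
        ∑ s ∈ Finset.range (p.natDegree + 1), (p.coeff s : F) * (y j : F) ^ s := by
      intro j
      rw [Polynomial.eval_eq_sum_range]
      push_cast
      rfl
    simp_rw [Finset.mul_sum, ← mul_assoc]
    rw [Finset.sum_comm]
    simp_rw [← Finset.sum_mul, ← heval]
    rw [Finset.sum_eq_single i]
    · rw [Lagrange.eval_basis_self hinj (Finset.mem_univ i)]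
      simp
    · intro j _ hj
      rw [Lagrange.eval_basis_of_ne hj.symm (Finset.mem_univ j)]
      simp
    · simp
  rw [hw]
  refine sum_mem fun s hs => mul_mem (p.coeff s).2 (h s ?_)
  rw [← hdeg]
  exact Finset.mem_range.mp hs

/-- A set of cells of a grid, any two of which lie on a common line, lies on a single line. -/
theorem exists_fst_eq_or_exists_snd_eq {ι α β : Type*} [Nonempty ι] (b : ι → α × β)
    (h : ∀ i j, (b i).1 = (b j).1 ∨ (b i).2 = (b j).2) :
    (∃ c, ∀ i, (b i).1 = c) ∨ ∃ c, ∀ i, (b i).2 = c := by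
  by_contra! hcon
  obtain ⟨i₀⟩ := ‹Nonempty ι›
  obtain ⟨j, hj⟩ := hcon.1 (b i₀).1
  obtain ⟨l, hl⟩ := hcon.2 (b i₀).2
  have := h i₀ j
  have := h i₀ l
  have := h j l
  grind

section FractionRing

variable {k σ : Type} [Field k]

/-- The inverses of the variables are algebraically independent. -/
theorem algebraicIndependent_inv_X [Finite σ] :
    AlgebraicIndependent k fun i : σ =>
      (algebraMap (MvPolynomial σ k) (FractionRing (MvPolynomial σ k)) (MvPolynomial.X i))⁻¹ := by
  set F := FractionRing (MvPolynomial σ k)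
  set x : σ → F := fun i => algebraMap (MvPolynomial σ k) F (MvPolynomial.X i)
  have hx : AlgebraicIndependent k x := by
    have : MvPolynomial.aeval x = IsScalarTower.toAlgHom k (MvPolynomial σ k) F :=
      MvPolynomial.algHom_ext fun i => by simp [x]
    rw [AlgebraicIndependent, this]
    exact IsFractionRing.injective _ _
  set A := Algebra.adjoin k (Set.range fun i => (x i)⁻¹)
  have halgX : ∀ i, IsAlgebraic A (x i) := by
    intro i
    have h : IsAlgebraic A ((x i)⁻¹) :=
      isAlgebraic_algebraMap (⟨_, Algebra.subset_adjoin ⟨i, rfl⟩⟩ : A)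
    exact inv_inv (x i) ▸ h.inv
  have halgP : ∀ p : MvPolynomial σ k, IsAlgebraic A (algebraMap (MvPolynomial σ k) F p) := by
    intro p
    induction p using MvPolynomial.induction_on with
    | C a =>
      have : algebraMap (MvPolynomial σ k) F (MvPolynomial.C a) =
          algebraMap A F (algebraMap k A a) := by
        rw [← IsScalarTower.algebraMap_apply k A F,
          IsScalarTower.algebraMap_apply k (MvPolynomial σ k) F]
        rfl
      rw [this]
      exact isAlgebraic_algebraMap _
    | add p q hp hq => rw [map_add]; exact hp.add hq
    | mul_X p i hp => rw [map_mul]; exact hp.mul (halgX i)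
  have : Algebra.IsAlgebraic A F := ⟨fun z => by
    obtain ⟨p, q, -, rfl⟩ := IsFractionRing.div_surjective (A := MvPolynomial σ k) z
    rw [div_eq_mul_inv]
    exact (halgP p).mul (halgP q).inv⟩
  exact (Algebra.IsAlgebraic.isTranscendenceBasis_of_le_trdeg_of_finite k (fun i => (x i)⁻¹)
    hx.cardinalMk_le_trdeg).1

/-- Two endomorphisms of a rational function field agreeing on the variables are equal. -/
theorem algHom_fractionRing_ext {L : Type*} [Field L] [Algebra k L]
    {f g : FractionRing (MvPolynomial σ k) →ₐ[k] L}
    (h : ∀ i, f (algebraMap (MvPolynomial σ k) _ (MvPolynomial.X i)) =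
      g (algebraMap (MvPolynomial σ k) _ (MvPolynomial.X i))) : f = g := by
  have : f.comp (IsScalarTower.toAlgHom k (MvPolynomial σ k) _) =
      g.comp (IsScalarTower.toAlgHom k (MvPolynomial σ k) _) :=
    MvPolynomial.algHom_ext h
  refine AlgHom.ext fun z => ?_
  obtain ⟨p, q, -, rfl⟩ := IsFractionRing.div_surjective (A := MvPolynomial σ k) z
  rw [map_div₀, map_div₀]
  exact congrArg₂ _ (DFunLike.congr_fun this p) (DFunLike.congr_fun this q)

/-- There is an automorphism inverting all the variables. -/
theorem exists_algEquiv_inv_X [Finite σ] :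
    ∃ φ : FractionRing (MvPolynomial σ k) ≃ₐ[k] FractionRing (MvPolynomial σ k),
      ∀ i, φ (algebraMap (MvPolynomial σ k) _ (MvPolynomial.X i)) =
        (algebraMap (MvPolynomial σ k) _ (MvPolynomial.X i))⁻¹ := by
  let ev : MvPolynomial σ k →ₐ[k] FractionRing (MvPolynomial σ k) :=
    MvPolynomial.aeval fun i => (algebraMap (MvPolynomial σ k) _ (MvPolynomial.X i))⁻¹
  have hinj : Function.Injective ev := algebraicIndependent_inv_X
  let φ : FractionRing (MvPolynomial σ k) →ₐ[k] FractionRing (MvPolynomial σ k) :=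
    IsFractionRing.liftAlgHom hinj
  have hφ : ∀ i : σ, φ (algebraMap (MvPolynomial σ k) _ (MvPolynomial.X i)) =
      (algebraMap (MvPolynomial σ k) _ (MvPolynomial.X i))⁻¹ := fun i =>
    (IsFractionRing.lift_algebraMap (g := ev.toRingHom) hinj _).trans
      (MvPolynomial.aeval_X _ i)
  have hinv : φ.comp φ = AlgHom.id k _ := algHom_fractionRing_ext fun i => by simp [hφ]
  exact ⟨AlgEquiv.ofAlgHom φ φ hinv hinv, hφ⟩

/-- A permutation of the variables extends to an automorphism. -/
theorem exists_algEquiv_rename_X (e : Equiv.Perm σ) :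
    ∃ φ : FractionRing (MvPolynomial σ k) ≃ₐ[k] FractionRing (MvPolynomial σ k),
      ∀ i, φ (algebraMap (MvPolynomial σ k) _ (MvPolynomial.X i)) =
        algebraMap (MvPolynomial σ k) _ (MvPolynomial.X (e i)) :=
  ⟨IsFractionRing.algEquivOfAlgEquiv (MvPolynomial.renameEquiv k e), fun i => by simp⟩

end FractionRing

section Cocycle

variable {F : Type*} [Field F] {n : ℕ} {x : Fin n → F} {t : Fin n → Fin n → F}

theorem exists_perm_of_row_eq (i₀ c : Fin n) (hx : ∀ i, x i ≠ 0)
    (hmul : ∀ i j l, t i j * t j l = t i l) (hdiag : ∀ i, t i i = 1)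
    (hoff : ∀ i j, i ≠ j → t i j ≠ 1) (hrow : ∀ j, j ≠ i₀ → ∃ b, t i₀ j = x c / x b) :
    ∃ σ : Equiv.Perm (Fin n), ∀ i j, t i j = x (σ i) / x (σ j) := by
  have hrow' : ∀ j, ∃ b, t i₀ j = x c / x b := by
    intro j
    rcases eq_or_ne j i₀ with rfl | hj
    · exact ⟨c, by rw [hdiag, div_self (hx c)]⟩
    · exact hrow j hj
  choose s hs using hrow'
  have ht : ∀ i j, t i j = x (s i) / x (s j) := by
    intro i j
    have h := hmul i₀ i j
    rw [hs, hs] at h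
    have := hx c
    have := hx (s i)
    have := hx (s j)
    field_simp at h ⊢
    exact h
  have hinj : Function.Injective s := by
    intro i j hij
    by_contra hne
    exact hoff i j hne (by rw [ht, hij, div_self (hx _)])
  exact ⟨Equiv.ofBijective s (Finite.injective_iff_bijective.mp hinj), ht⟩

/-- A multiplicative cocycle all of whose values are ratios of distinct variables arises from a
permutation of the variables, possibly followed by their inversion. -/
theorem exists_perm_of_cocycle (hn : 2 ≤ n) (hx : ∀ i, x i ≠ 0) (hinj : Function.Injective x)
    (hdiv : ∀ a b c d e f, a ≠ b → c ≠ d → e ≠ f → x a / x b / (x c / x d) = x e / x f →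
      a = c ∨ b = d)
    (hmul : ∀ i j l, t i j * t j l = t i l)
    (hroot : ∀ i j, i ≠ j → ∃ a b, a ≠ b ∧ t i j = x a / x b) :
    ∃ σ : Equiv.Perm (Fin n), (∀ i j, t i j = x (σ i) / x (σ j)) ∨
      ∀ i j, t i j = x (σ j) / x (σ i) := by
  have hne : ∀ i j, i ≠ j → t i j ≠ 0 := by
    intro i j hij
    obtain ⟨a, b, -, h⟩ := hroot i j hij
    rw [h]
    exact div_ne_zero (hx a) (hx b)
  have hoff : ∀ i j, i ≠ j → t i j ≠ 1 := by
    intro i j hij h1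
    obtain ⟨a, b, hab, h⟩ := hroot i j hij
    rw [h1, eq_comm, div_eq_one_iff_eq (hx b)] at h
    exact hab (hinj h)
  have hnt : Nontrivial (Fin n) := Fin.nontrivial_iff_two_le.mpr hn
  have hdiag : ∀ i, t i i = 1 := by
    intro i
    obtain ⟨j, hj⟩ := exists_ne i
    exact mul_right_cancel₀ (hne i j hj.symm) (by rw [hmul, one_mul])
  let i₀ : Fin n := ⟨0, by omega⟩
  choose β₁ β₂ hβ hβt using fun j : {j // j ≠ i₀} => hroot i₀ j j.2.symm
  have hnonempty : Nonempty {j // j ≠ i₀} := nonempty_subtype.mpr (exists_ne i₀)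
  have hline : ∀ j l, β₁ j = β₁ l ∨ β₂ j = β₂ l := by
    intro j l
    rcases eq_or_ne j l with rfl | hjl
    · exact Or.inl rfl
    obtain ⟨e, f, hef, h⟩ := hroot l j fun h => hjl (Subtype.ext h.symm)
    refine hdiv _ _ _ _ e f (hβ j) (hβ l) hef ?_
    rw [← hβt, ← hβt, ← h, ← hmul i₀ l j, mul_div_cancel_left₀ _ (hne _ _ l.2.symm)]
  rcases exists_fst_eq_or_exists_snd_eq (fun j => (β₁ j, β₂ j)) hline with ⟨c, hc⟩ | ⟨c, hc⟩
  · obtain ⟨σ, hσ⟩ := exists_perm_of_row_eq i₀ c hx hmul hdiag hoff fun j hj =>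
      ⟨β₂ ⟨j, hj⟩, by rw [hβt ⟨j, hj⟩, ← hc ⟨j, hj⟩]⟩
    exact ⟨σ, Or.inl hσ⟩
  · obtain ⟨σ, hσ⟩ := exists_perm_of_row_eq (t := fun i j => t j i) i₀ c hx
      (fun i j l => by rw [mul_comm, hmul]) hdiag (fun i j hij => hoff j i hij.symm) fun j hj =>
      ⟨β₁ ⟨j, hj⟩, by
        have h := hmul i₀ j i₀
        rw [hdiag, hβt ⟨j, hj⟩] at h
        rw [eq_inv_of_mul_eq_one_right h, inv_div, ← hc ⟨j, hj⟩]⟩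
    exact ⟨σ, Or.inr fun i j => hσ j i⟩

end Cocycle

theorem card_lt_pairs (n : ℕ) :
    Fintype.card {p : Fin n × Fin n // p.1 < p.2} = n * (n - 1) / 2 := by
  rw [Fintype.card_subtype, Finset.card_filter, Fintype.sum_prod_type]
  simp_rw [← Finset.card_filter]
  rw [Finset.sum_congr rfl fun i _ => (by simp [Finset.filter_lt_eq_Ioi] :
    (Finset.univ.filter fun j : Fin n => i < j).card = n - 1 - i)]
  rw [Fin.sum_univ_eq_sum_range (fun i => n - 1 - i), Finset.sum_range_reflect (fun i => i),
    Finset.sum_range_id]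

theorem card_ne_pairs (n : ℕ) :
    Fintype.card {p : Fin n × Fin n // p.1 ≠ p.2} = n * (n - 1) := by
  have := Finset.offDiag_card (Finset.univ : Finset (Fin n))
  rw [Fintype.card_subtype]
  rw [Finset.card_univ, Fintype.card_fin, ← Nat.mul_sub_one] at this
  rw [← this]
  congr 1
  ext p
  simp

section Polynomial

open Polynomial

variable {k F : Type*} [Field k] [CharZero k] [Field F] [Algebra k F] {n : ℕ}

theorem sum_lt_pairs_mem (E : IntermediateField k F) (f : Fin n → Fin n → F)
    (hsymm : ∀ i j, f i j = f j i) (hdiag : ∀ i, f i i ∈ E) (h : ∑ i, ∑ j, f i j ∈ E) :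
    ∑ p : {p : Fin n × Fin n // p.1 < p.2}, f p.1.1 p.1.2 ∈ E := by
  have hsplit : ∑ i, ∑ j, f i j =
      2 * ∑ p : {p : Fin n × Fin n // p.1 < p.2}, f p.1.1 p.1.2 + ∑ i, f i i := by
    have hsub : ∑ p : {p : Fin n × Fin n // p.1 < p.2}, f p.1.1 p.1.2 =
        ∑ i, ∑ j, if i < j then f i j else 0 := by
      rw [← Fintype.sum_prod_type' (fun i j => if i < j then f i j else 0),
        ← Finset.sum_filter, ← Finset.sum_subtype_eq_sum_filter]
      simp
    have hsub' : ∑ p : {p : Fin n × Fin n // p.1 < p.2}, f p.1.1 p.1.2 =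
        ∑ i, ∑ j, if j < i then f i j else 0 := by
      rw [hsub, Finset.sum_comm]
      simp_rw [hsymm]
    have hd : ∑ i, f i i = ∑ i, ∑ j, if i = j then f i j else 0 := by simp
    rw [two_mul]
    nth_rewrite 1 [hsub]
    rw [hsub', hd, ← Finset.sum_add_distrib, ← Finset.sum_add_distrib]
    refine Finset.sum_congr rfl fun i _ => ?_
    rw [← Finset.sum_add_distrib, ← Finset.sum_add_distrib]
    refine Finset.sum_congr rfl fun j _ => ?_
    rcases lt_trichotomy i j with hij | rfl | hij
    · simp [hij, hij.not_gt, hij.ne]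
    · simp
    · simp [hij, hij.not_gt, hij.ne']
  have : CharZero F := charZero_of_injective_algebraMap (algebraMap k F).injective
  have h2 : (2 : F) ∈ E := ofNat_mem E 2
  rw [eq_comm, ← eq_sub_iff_add_eq] at hsplit
  rw [← mul_div_cancel_left₀ (∑ p : {p : Fin n × Fin n // p.1 < p.2}, f p.1.1 p.1.2)
    (two_ne_zero' F), hsplit]
  exact div_mem (sub_mem h (sum_mem fun i _ => hdiag i)) h2

/-- The monic polynomial with roots `x i / x j`, `i ≠ j`, is defined over any field containing
`tr(X^r) tr(X^{-r})` for `1 ≤ r ≤ n(n-1)/2`. -/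
theorem exists_map_eq_prod_ratios (E : IntermediateField k F) (x : Fin n → F) (hx : ∀ i, x i ≠ 0)
    (hE : ∀ r : ℕ, 1 ≤ r → r ≤ n * (n - 1) / 2 →
      (∑ j, x j ^ (r : ℤ)) * (∑ j, x j ^ (-(r : ℤ))) ∈ E) :
    ∃ p : E[X], p.map (algebraMap E F) = ∏ p : {p : Fin n × Fin n // p.1 < p.2},
      ((X - C (x p.1.1 / x p.1.2)) * (X - C (x p.1.2 / x p.1.1))) := by
  have hEz : ∀ r : ℤ, r.natAbs ≤ n * (n - 1) / 2 → ∑ i, ∑ j, (x i / x j) ^ r ∈ E := by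
    intro r hr
    have hprod : ∑ i, ∑ j, (x i / x j) ^ r = (∑ j, x j ^ r) * ∑ j, x j ^ (-r) := by
      rw [Finset.sum_mul_sum]
      simp_rw [div_zpow, zpow_neg, div_eq_mul_inv]
    rw [hprod]
    rcases Nat.eq_zero_or_pos r.natAbs with h0 | hpos
    · rw [Int.natAbs_eq_zero.mp h0]
      simpa using mul_mem (natCast_mem E n) (natCast_mem E n)
    · rcases Int.natAbs_eq r with h | h
      · rw [h]
        exact hE _ hpos hr
      · rw [h, neg_neg, mul_comm]
        exact hE _ hpos hr
  have hz : ∀ l ≤ n * (n - 1) / 2,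
      ∑ p : {p : Fin n × Fin n // p.1 < p.2}, (x p.1.1 / x p.1.2 + x p.1.2 / x p.1.1) ^ l ∈ E := by
    intro l hl
    refine sum_lt_pairs_mem E (fun i j => (x i / x j + x j / x i) ^ l)
      (fun i j => by rw [add_comm]) (fun i => ?_) ?_
    · rw [div_self (hx i)]
      exact pow_mem (add_mem (one_mem E) (one_mem E)) l
    · have hbinom : ∀ i j, (x i / x j + x j / x i) ^ l =
          ∑ a ∈ Finset.range (l + 1), (x i / x j) ^ (2 * (a : ℤ) - l) * (l.choose a : F) := by
        intro i j
        rw [add_pow]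
        refine Finset.sum_congr rfl fun a ha => ?_
        have hal : a ≤ l := Nat.lt_succ_iff.mp (Finset.mem_range.mp ha)
        have hy : x i / x j ≠ 0 := div_ne_zero (hx i) (hx j)
        rw [← inv_div (x i) (x j), ← zpow_natCast, ← zpow_natCast, inv_zpow', ← zpow_add₀ hy]
        congr 2
        push_cast [hal]
        ring
      simp_rw [hbinom]
      simp_rw [Finset.sum_comm (t := Finset.range (l + 1)), ← Finset.sum_mul]
      refine sum_mem fun a ha => mul_mem (hEz _ ?_) (natCast_mem E _)
      have := Finset.mem_range.mp ha
      omega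
  let S : Subalgebra k F[X] := (mapAlgHom E.val).range
  have hC : ∀ c ∈ E, C c ∈ S := fun c hc => ⟨C ⟨c, hc⟩, by simp⟩
  have hX : (X : F[X]) ∈ S := ⟨X, by simp⟩
  suffices h : ∏ p : {p : Fin n × Fin n // p.1 < p.2},
      ((X - C (x p.1.1 / x p.1.2)) * (X - C (x p.1.2 / x p.1.1))) ∈ S by
    obtain ⟨p, hp⟩ := h
    exact ⟨p, hp⟩
  have hquad : ∀ p : {p : Fin n × Fin n // p.1 < p.2},
      (X - C (x p.1.1 / x p.1.2)) * (X - C (x p.1.2 / x p.1.1)) =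
        -(X * C (x p.1.1 / x p.1.2 + x p.1.2 / x p.1.1)) + (X ^ 2 + 1) := by
    intro p
    have h1 : C (x p.1.1 / x p.1.2) * C (x p.1.2 / x p.1.1) = 1 := by
      rw [← C_mul, div_mul_div_cancel₀ (hx _), div_self (hx _), C_1]
    rw [C_add]
    linear_combination h1
  simp_rw [hquad]
  refine prod_mem_of_sum_pow_mem S _ fun r _ hr => ?_
  rw [card_lt_pairs] at hr
  simp_rw [add_pow (-(_ : F[X])), neg_pow (_ * _ : F[X]), mul_pow, ← C_pow]
  rw [Finset.sum_comm]
  refine sum_mem fun l hl => ?_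
  rw [← Finset.sum_mul, ← Finset.sum_mul, ← Finset.mul_sum, ← Finset.mul_sum, ← map_sum]
  have hl' : l ≤ r := Nat.lt_succ_iff.mp (Finset.mem_range.mp hl)
  exact mul_mem (mul_mem (mul_mem (pow_mem (neg_mem (one_mem S)) _)
    (mul_mem (pow_mem hX _) (hC _ (hz l (hl'.trans hr)))))
    (pow_mem (add_mem (pow_mem hX _) (one_mem S)) _)) (natCast_mem S _)

end Polynomial

section Variables

variable {k : Type} [Field k] {m n : ℕ}

theorem xm_ne_zero (h : Fin m) (j : Fin n) : xm k m n h j ≠ 0 := by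
  simp [xm]

theorem xm_injective (h : Fin m) : Function.Injective (xm k m n h) := by
  intro i j hij
  simpa using MvPolynomial.X_injective (IsFractionRing.injective _ _ hij)

theorem eq_of_xm_mul_eq (h : Fin m) {a d f e b c : Fin n}
    (heq : xm k m n h a * xm k m n h d * xm k m n h f =
      xm k m n h e * xm k m n h b * xm k m n h c) : a = e ∨ a = b ∨ a = c := by
  simp only [xm, ← map_mul] at heq
  have hprime := MvPolynomial.X_prime (R := k) (i := (h, a))
  have hdvd := IsFractionRing.injective _ _ heq ▸
    Dvd.intro _ (mul_assoc (MvPolynomial.X (h, a) : MvPolynomial (Fin m × Fin n) k) _ _).symm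
  simpa [hprime.dvd_mul, MvPolynomial.X_dvd_X, or_assoc] using hdvd

theorem xm_div_eq_xm_div (h : Fin m) {a b c d : Fin n} (hab : a ≠ b)
    (heq : xm k m n h a / xm k m n h b = xm k m n h c / xm k m n h d) : a = c ∧ b = d := by
  have hb := xm_ne_zero (k := k) h b
  have hc := xm_ne_zero (k := k) h c
  have hd := xm_ne_zero (k := k) h d
  have hac : a = c := by
    have := eq_of_xm_mul_eq (k := k) h (a := a) (d := d) (f := b) (e := c) (b := b) (c := b)
      (by rw [div_eq_div_iff hb hd] at heq; rw [heq])
    tauto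
  subst hac
  refine ⟨rfl, xm_injective (k := k) h ?_⟩
  field_simp at heq
  exact heq.symm

theorem xm_div_div_eq (h : Fin m) {a b c d e f : Fin n} (hab : a ≠ b) (hcd : c ≠ d)
    (heq : xm k m n h a / xm k m n h b / (xm k m n h c / xm k m n h d) =
      xm k m n h e / xm k m n h f) : a = c ∨ b = d := by
  have ha := xm_ne_zero (k := k) h a
  have hb := xm_ne_zero (k := k) h b
  have hc := xm_ne_zero (k := k) h c
  have hd := xm_ne_zero (k := k) h d
  have hf := xm_ne_zero (k := k) h f
  have heq' : xm k m n h a * xm k m n h d * xm k m n h f =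
      xm k m n h e * xm k m n h b * xm k m n h c := by
    field_simp at heq
    linear_combination heq
  rcases eq_of_xm_mul_eq h heq' with rfl | rfl | rfl
  · have := eq_of_xm_mul_eq (k := k) h (a := d) (d := f) (f := f) (e := b) (b := c) (c := f)
      (mul_left_cancel₀ ha (by linear_combination xm k m n h f * heq'))
    have := eq_of_xm_mul_eq (k := k) h (a := d) (d := f) (f := d) (e := b) (b := c) (c := d)
      (mul_left_cancel₀ ha (by linear_combination xm k m n h d * heq'))
    have := eq_of_xm_mul_eq (k := k) h (a := d) (d := f) (f := c) (e := b) (b := c) (c := c)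
      (mul_left_cancel₀ ha (by linear_combination xm k m n h c * heq'))
    grind
  · exact absurd rfl hab
  · exact Or.inl rfl

theorem exists_mem_GsubM_perm (σ : Equiv.Perm (Fin n)) :
    ∃ φ ∈ GsubM k m n, ∀ h j, φ (xm k m n h j) = xm k m n h (σ j) := by
  obtain ⟨φ, hφ⟩ := exists_algEquiv_rename_X (k := k) ((Equiv.refl (Fin m)).prodCongr σ)
  have hφ' : ∀ h j, φ (xm k m n h j) = xm k m n h (σ j) := fun h j => hφ (h, j)
  exact ⟨φ, Subgroup.subset_closure ⟨σ, Or.inl hφ'⟩, hφ'⟩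

theorem exists_mem_GsubM_inv (σ : Equiv.Perm (Fin n)) :
    ∃ φ ∈ GsubM k m n, ∀ h j, φ (xm k m n h j) = (xm k m n h (σ j))⁻¹ := by
  obtain ⟨φ, -, hφ⟩ := exists_mem_GsubM_perm (k := k) (m := m) σ
  obtain ⟨ψ, hψ⟩ := exists_algEquiv_inv_X (k := k) (σ := Fin m × Fin n)
  have hφψ : ∀ h j, (φ.trans ψ) (xm k m n h j) = (xm k m n h (σ j))⁻¹ := fun h j => by
    rw [AlgEquiv.trans_apply, hφ]
    exact hψ (h, σ j)
  exact ⟨_, Subgroup.subset_closure ⟨σ, Or.inr hφψ⟩, hφψ⟩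

/-- An element fixed by the permutations of the variables and by their composites with the
inversion is fixed by the whole group. -/
theorem mem_fixedField_GsubM {v : RFM k m n}
    (hv : ∀ φ : RFM k m n ≃ₐ[k] RFM k m n, ∀ σ : Equiv.Perm (Fin n),
      ((∀ h j, φ (xm k m n h j) = xm k m n h (σ j)) ∨
        ∀ h j, φ (xm k m n h j) = (xm k m n h (σ j))⁻¹) → φ v = v) :
    v ∈ IntermediateField.fixedField (GsubM k m n) := by
  rw [IntermediateField.mem_fixedField_iff]
  intro φ hφ
  have hle : GsubM k m n ≤ MulAction.stabilizer (RFM k m n ≃ₐ[k] RFM k m n) v := by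
    rw [GsubM, Subgroup.closure_le]
    rintro φ ⟨σ, hσ⟩
    exact hv φ σ hσ
  exact hle hφ

theorem qSingle_mem_fixedField (h : Fin m) (r : ℤ) :
    qSingle k m n h r ∈ IntermediateField.fixedField (GsubM k m n) := by
  refine mem_fixedField_GsubM fun φ σ hφ => ?_
  have hsum : ∀ s : ℤ, ∑ j, xm k m n h (σ j) ^ s = ∑ j, xm k m n h j ^ s := fun s =>
    Equiv.sum_comp σ fun j => xm k m n h j ^ s
  rcases hφ with hφ | hφ
  · simp only [qSingle, map_mul, map_sum, map_zpow₀, hφ, hsum]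
  · simp only [qSingle, map_mul, map_sum, map_zpow₀, hφ, inv_zpow', hsum, neg_neg]
    rw [mul_comm]

theorem qMix_mem_fixedField (h₁ h : Fin m) (s : ℤ) :
    qMix k m n h₁ h s ∈ IntermediateField.fixedField (GsubM k m n) := by
  refine mem_fixedField_GsubM fun φ σ hφ => ?_
  have hsum : ∀ s : ℤ, ∑ j, xm k m n h₁ (σ j) ^ s * xm k m n h (σ j) =
      ∑ j, xm k m n h₁ j ^ s * xm k m n h j := fun s =>
    Equiv.sum_comp σ fun j => xm k m n h₁ j ^ s * xm k m n h j
  have hsum' : ∀ s : ℤ, ∑ j, xm k m n h₁ (σ j) ^ s * (xm k m n h (σ j))⁻¹ =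
      ∑ j, xm k m n h₁ j ^ s * (xm k m n h j)⁻¹ := fun s =>
    Equiv.sum_comp σ fun j => xm k m n h₁ j ^ s * (xm k m n h j)⁻¹
  rcases hφ with hφ | hφ
  · simp only [qMix, map_mul, map_sum, map_zpow₀, map_inv₀, hφ, hsum, hsum']
  · simp only [qMix, map_mul, map_sum, map_zpow₀, map_inv₀, hφ, inv_zpow', hsum, hsum', neg_neg,
      inv_inv]
    rw [mul_comm]

theorem xm_div_mem (h : Fin m) (i j : Fin n) :
    xm k m n h i / xm k m n h j ∈ IntermediateField.adjoin k (ratioSetM k m n) := by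
  rcases eq_or_ne i j with rfl | hij
  · rw [div_self (xm_ne_zero h i)]
    exact one_mem _
  · exact IntermediateField.subset_adjoin _ _ ⟨h, i, j, hij, rfl⟩

theorem qSingle_eq_sum (h : Fin m) (r : ℤ) :
    qSingle k m n h r = ∑ i, ∑ j, (xm k m n h i / xm k m n h j) ^ r := by
  rw [qSingle, Finset.sum_mul_sum]
  simp_rw [div_zpow, zpow_neg, div_eq_mul_inv]

theorem qMix_eq_sum (h₁ h : Fin m) (s : ℤ) :
    qMix k m n h₁ h s = ∑ i, ∑ j,
      (xm k m n h₁ i / xm k m n h₁ j) ^ s * (xm k m n h i / xm k m n h j) := by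
  rw [qMix, Finset.sum_mul_sum]
  refine Finset.sum_congr rfl fun i _ => Finset.sum_congr rfl fun j _ => ?_
  rw [div_zpow, zpow_neg]
  ring

theorem qSingle_mem_InvFM (h : Fin m) (r : ℤ) : qSingle k m n h r ∈ InvFM k m n := by
  refine ⟨?_, qSingle_mem_fixedField h r⟩
  rw [qSingle_eq_sum]
  exact sum_mem fun i _ => sum_mem fun j _ => zpow_mem (xm_div_mem h i j) r

theorem qMix_mem_InvFM (h₁ h : Fin m) (s : ℤ) : qMix k m n h₁ h s ∈ InvFM k m n := by
  refine ⟨?_, qMix_mem_fixedField h₁ h s⟩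
  rw [qMix_eq_sum]
  exact sum_mem fun i _ => sum_mem fun j _ =>
    mul_mem (zpow_mem (xm_div_mem h₁ i j) s) (xm_div_mem h i j)

/-- The ratios of every array lie in any field containing the ratios of one array and the first
`n(n-1)` mixed observables. -/
theorem xm_div_mem_of_qMix_mem {E : IntermediateField k (RFM k m n)}
    (L : IntermediateField E (RFM k m n)) (h₁ h : Fin m)
    (hL : ∀ i j, xm k m n h₁ i / xm k m n h₁ j ∈ L)
    (hq : ∀ s : ℕ, s ≤ n * (n - 1) - 1 → qMix k m n h₁ h s ∈ L) (i j : Fin n) :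
    xm k m n h i / xm k m n h j ∈ L := by
  rcases eq_or_ne i j with rfl | hij
  · rw [div_self (xm_ne_zero h i)]
    exact one_mem _
  refine mem_of_sum_pow_mul_mem (ι := {p : Fin n × Fin n // p.1 ≠ p.2}) L
    (fun p => ⟨_, hL p.1.1 p.1.2⟩) ?_ (fun p => xm k m n h p.1.1 / xm k m n h p.1.2) ?_
    ⟨(i, j), hij⟩
  · intro p q hpq
    have := xm_div_eq_xm_div h₁ p.2 (Subtype.ext_iff.mp hpq)
    exact Subtype.ext (Prod.ext this.1 this.2)
  · intro s hs
    rw [card_ne_pairs] at hs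
    have hsplit : qMix k m n h₁ h s = n + ∑ p : {p : Fin n × Fin n // p.1 ≠ p.2},
        (xm k m n h₁ p.1.1 / xm k m n h₁ p.1.2) ^ s *
          (xm k m n h p.1.1 / xm k m n h p.1.2) := by
      rw [qMix_eq_sum, ← Fintype.sum_prod_type' (fun i j =>
        (xm k m n h₁ i / xm k m n h₁ j) ^ (s : ℤ) * (xm k m n h i / xm k m n h j)),
        ← Fintype.sum_subtype_add_sum_subtype (fun p : Fin n × Fin n => p.1 = p.2)]
      congr 1
      have hone : ∀ p : {p : Fin n × Fin n // p.1 = p.2},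
          (xm k m n h₁ p.1.1 / xm k m n h₁ p.1.2) ^ (s : ℤ) *
            (xm k m n h p.1.1 / xm k m n h p.1.2) = 1 := by
        intro p
        rw [p.2, div_self (xm_ne_zero _ _), div_self (xm_ne_zero _ _), one_zpow, one_mul]
      have hcard : Fintype.card {p : Fin n × Fin n // p.1 = p.2} = n := by
        rw [Fintype.card_congr (⟨fun p => p.1.1, fun i => ⟨(i, i), rfl⟩,
          fun p => Subtype.ext (Prod.ext rfl p.2), fun _ => rfl⟩ :
          {p : Fin n × Fin n // p.1 = p.2} ≃ Fin n), Fintype.card_fin]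
      simp_rw [hone]
      simp [hcard]
    rw [← add_sub_cancel_left (n : RFM k m n) (∑ p : {p : Fin n × Fin n // p.1 ≠ p.2},
        (xm k m n h₁ p.1.1 / xm k m n h₁ p.1.2) ^ s *
          (xm k m n h p.1.1 / xm k m n h p.1.2)), ← hsplit]
    exact sub_mem (hq s (by omega)) (natCast_mem L n)

end Variables

open Polynomial in
/-- A subfield of the invariant field over which the ratios of one array are the roots of a
polynomial, and over which these ratios generate all ratios, is the whole invariant field. -/
theorem InvFM_le_of_map_eq_prod {k : Type} [Field k] [CharZero k] {m n : ℕ} (hn : 2 ≤ n)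
    (h₁ : Fin m) (E : IntermediateField k (RFM k m n)) (hE : E ≤ InvFM k m n) (p : E[X])
    (hp : p.map (algebraMap E (RFM k m n)) = ∏ p : {p : Fin n × Fin n // p.1 < p.2},
      ((X - C (xm k m n h₁ p.1.1 / xm k m n h₁ p.1.2)) *
        (X - C (xm k m n h₁ p.1.2 / xm k m n h₁ p.1.1))))
    (hgen : ∀ L : IntermediateField E (RFM k m n),
      (∀ i j, xm k m n h₁ i / xm k m n h₁ j ∈ L) → ∀ h i j, xm k m n h i / xm k m n h j ∈ L) :
    InvFM k m n ≤ E := by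
  set F := RFM k m n
  set x := xm k m n h₁
  have hx : ∀ i, x i ≠ 0 := xm_ne_zero h₁
  have hp0 : p.map (algebraMap E F) ≠ 0 := by
    rw [hp]
    exact Finset.prod_ne_zero_iff.mpr fun _ _ => mul_ne_zero (X_sub_C_ne_zero _) (X_sub_C_ne_zero _)
  have hsplits : (p.map (algebraMap E F)).Splits := by
    rw [hp]
    exact Splits.prod fun _ _ => (Splits.X_sub_C _).mul (Splits.X_sub_C _)
  have hroot : ∀ z : F, z ∈ p.rootSet F ↔ ∃ i j, i ≠ j ∧ z = x i / x j := by
    intro z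
    rw [mem_rootSet', and_iff_right hp0, aeval_def, ← eval_map, hp, eval_prod,
      Finset.prod_eq_zero_iff]
    simp only [Finset.mem_univ, true_and, eval_mul, eval_sub, eval_X, eval_C, mul_eq_zero,
      sub_eq_zero]
    constructor
    · rintro ⟨⟨⟨i, j⟩, hij⟩, h | h⟩
      · exact ⟨i, j, hij.ne, h⟩
      · exact ⟨j, i, hij.ne', h⟩
    · rintro ⟨i, j, hij, h⟩
      rcases lt_or_gt_of_ne hij with hij | hij
      · exact ⟨⟨(i, j), hij⟩, Or.inl h⟩
      · exact ⟨⟨(j, i), hij⟩, Or.inr h⟩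
  set L := IntermediateField.adjoin E (p.rootSet F)
  have hLx : ∀ i j, x i / x j ∈ L := by
    intro i j
    rcases eq_or_ne i j with rfl | hij
    · rw [div_self (hx i)]
      exact one_mem _
    · exact IntermediateField.subset_adjoin _ _ ((hroot _).mpr ⟨i, j, hij, rfl⟩)
  have : p.IsSplittingField E L := IntermediateField.adjoin_rootSet_isSplittingField hsplits
  have : Normal E L := Normal.of_isSplittingField p
  have : CharZero E := charZero_of_injective_algebraMap (algebraMap k E).injective
  have : Algebra.IsAlgebraic E L := Normal.toIsAlgebraic
  have : Algebra.IsSeparable E L := Algebra.IsAlgebraic.isSeparable_of_perfectField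
  have : IsGalois E L := IsGalois.mk
  have hKL : ∀ a ∈ InvFM k m n, a ∈ L := by
    have hle : IntermediateField.adjoin k (ratioSetM k m n) ≤ L.restrictScalars k := by
      rw [IntermediateField.adjoin_le_iff]
      rintro _ ⟨h, i, j, -, rfl⟩
      exact hgen L hLx h i j
    exact fun a ha => hle ha.1
  intro a ha
  suffices hbot : (⟨a, hKL a ha⟩ : L) ∈ (⊥ : IntermediateField E L) by
    obtain ⟨e, he⟩ := IntermediateField.mem_bot.mp hbot
    have : (e : F) = a := congrArg Subtype.val he
    exact this ▸ e.2
  rw [InfiniteGalois.mem_bot_iff_fixed]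
  intro f
  let f' : L →ₐ[E] F := L.val.comp f.toAlgHom
  have hf'root : ∀ i j, i ≠ j → ∃ c d, c ≠ d ∧ f' ⟨_, hLx i j⟩ = x c / x d := by
    intro i j hij
    rw [← hroot, mem_rootSet', and_iff_right hp0, aeval_algHom_apply, ← map_zero f']
    congr 1
    have h := (mem_rootSet'.mp ((hroot _).mpr ⟨i, j, hij, rfl⟩)).2
    apply Subtype.val_injective
    rw [← IntermediateField.coe_val, ← aeval_algHom_apply]
    exact h
  obtain ⟨g, hg, hfg⟩ : ∃ g ∈ GsubM k m n, ∀ i j, f' ⟨_, hLx i j⟩ = g (x i / x j) := by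
    obtain ⟨σ, hσ | hσ⟩ := exists_perm_of_cocycle (t := fun i j => f' ⟨_, hLx i j⟩) hn hx
      (xm_injective h₁) (fun a b c d e f hab hcd _ => xm_div_div_eq h₁ hab hcd)
      (fun i j l => by
        rw [← map_mul]
        exact congrArg f' (Subtype.ext (div_mul_div_cancel₀ (hx j)))) hf'root
    · obtain ⟨g, hg, hgx⟩ := exists_mem_GsubM_perm (k := k) (m := m) σ
      exact ⟨g, hg, fun i j => by rw [hσ, map_div₀, hgx, hgx]⟩
    · obtain ⟨g, hg, hgx⟩ := exists_mem_GsubM_inv (k := k) (m := m) σ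
      exact ⟨g, hg, fun i j => by rw [hσ, map_div₀, hgx, hgx, inv_div_inv]⟩
  have hgE : ∀ e : E, g e = e := fun e =>
    (IntermediateField.mem_fixedField_iff _ _).mp (hE e.2).2 g hg
  let g' : F →ₐ[E] F := { g.toAlgHom.toRingHom with commutes' := hgE }
  have hfg' : f' = g'.comp L.val := by
    refine IntermediateField.algHom_ext_of_eq_adjoin E rfl fun z hz => ?_
    obtain ⟨i, j, -, rfl⟩ := (hroot z).mp hz
    exact hfg i j
  apply Subtype.ext
  calc ((f ⟨a, hKL a ha⟩ : L) : F) = f' ⟨a, hKL a ha⟩ := rfl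
    _ = g a := by rw [hfg']; rfl
    _ = a := (IntermediateField.mem_fixedField_iff _ _).mp ha.2 g hg

/-- `k(X_1,…,X_m)₀^G` is generated over `k` by the observables
`q_r = tr(X_1^r)·tr(X_1^{-r})`, `r = 1,…,n(n-1)/2`, together with
`q_s^{(h)} = tr(X_1^s X_h)·tr(X_1^{-s} X_h^{-1})`, `h = 2,…,m`,
`s = 0,…,n(n-1)−1`. -/
theorem stmt16 (k : Type) [Field k] [CharZero k] (m n : ℕ)
    (hm : 1 ≤ m) (hn : 2 ≤ n) :
    InvFM k m n =
      IntermediateField.adjoin k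
        ({v | ∃ r : ℕ, 1 ≤ r ∧ r ≤ n * (n - 1) / 2 ∧
            v = qSingle k m n ⟨0, hm⟩ (r : ℤ)} ∪
          {v | ∃ h : Fin m, h ≠ ⟨0, hm⟩ ∧ ∃ s : ℕ, s ≤ n * (n - 1) - 1 ∧
            v = qMix k m n ⟨0, hm⟩ h (s : ℤ)}) := by
  set E := IntermediateField.adjoin k
    ({v | ∃ r : ℕ, 1 ≤ r ∧ r ≤ n * (n - 1) / 2 ∧
        v = qSingle k m n ⟨0, hm⟩ (r : ℤ)} ∪
      {v | ∃ h : Fin m, h ≠ ⟨0, hm⟩ ∧ ∃ s : ℕ, s ≤ n * (n - 1) - 1 ∧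
        v = qMix k m n ⟨0, hm⟩ h (s : ℤ)})
  have hE : E ≤ InvFM k m n := by
    rw [IntermediateField.adjoin_le_iff]
    rintro _ (⟨r, -, -, rfl⟩ | ⟨h, -, s, -, rfl⟩)
    · exact qSingle_mem_InvFM _ _
    · exact qMix_mem_InvFM _ _ _
  refine le_antisymm ?_ hE
  obtain ⟨p, hp⟩ := exists_map_eq_prod_ratios E (xm k m n ⟨0, hm⟩) (xm_ne_zero _)
    fun r hr hr' => IntermediateField.subset_adjoin _ _ (Or.inl ⟨r, hr, hr', rfl⟩)
  refine InvFM_le_of_map_eq_prod hn ⟨0, hm⟩ E hE p hp fun L hL h => ?_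
  rcases eq_or_ne h ⟨0, hm⟩ with rfl | hh
  · exact hL
  · exact xm_div_mem_of_qMix_mem L _ h hL fun s hs => L.algebraMap_mem
      ⟨_, IntermediateField.subset_adjoin _ _ (Or.inr ⟨h, hh, s, hs, rfl⟩)⟩
end
end
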